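/- Let |Ψ⟩_ABC be a tripartite pure state whose reduced state ρ_BC is separable. If H(ρ_A) = H(ρ_AB) (vanishing conditional entropy H(B|A) with PPT environment), then ρ_AB is separable. -/

import Mathlib

open Matrix BigOperators
open scoped ComplexOrder

noncomputable section

/-- A density matrix: positive semidefinite with trace one. -/
def IsDensity {α : Type*} [Fintype α] (ρ : Matrix α α ℂ) : Prop :=
  ρ.PosSemidef ∧ ρ.trace = 1

/-- Tensor (Kronecker) product of matrices on a product index type. -/
def tens {α β : Type*} (σ : Matrix α α ℂ) (τ : Matrix β β ℂ) :
    Matrix (α × β) (α × β) ℂ :=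
  fun p q => σ p.1 q.1 * τ p.2 q.2

/-- Separability: a finite convex combination of product density matrices. -/
def SeparableState {α β : Type*} [Fintype α] [Fintype β]
    (ρ : Matrix (α × β) (α × β) ℂ) : Prop :=
  ∃ (k : ℕ) (p : Fin k → ℝ) (σ : Fin k → Matrix α α ℂ) (τ : Fin k → Matrix β β ℂ),
    (∀ i, 0 ≤ p i) ∧ ∑ i, p i = 1 ∧ (∀ i, IsDensity (σ i)) ∧ (∀ i, IsDensity (τ i)) ∧
    ρ = ∑ i, (p i : ℂ) • tens (σ i) (τ i)

/-- Partial transpose with respect to the second system. -/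
def ptransB {α β : Type*} (ρ : Matrix (α × β) (α × β) ℂ) :
    Matrix (α × β) (α × β) ℂ :=
  fun p q => ρ (p.1, q.2) (q.1, p.2)

/-- Partial trace over the second system. -/
def ptrB {α β : Type*} [Fintype β] (ρ : Matrix (α × β) (α × β) ℂ) : Matrix α α ℂ :=
  fun i k => ∑ j, ρ (i, j) (k, j)

/-- Partial trace over the first system. -/
def ptrA {α β : Type*} [Fintype α] (ρ : Matrix (α × β) (α × β) ℂ) : Matrix β β ℂ :=
  fun j l => ∑ i, ρ (i, j) (i, l)

/-- Rank-one projection |ψ⟩⟨ψ| associated with a vector. -/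
def projv {α : Type*} (ψ : α → ℂ) : Matrix α α ℂ :=
  fun x y => ψ x * (starRingEnd ℂ) (ψ y)

/-- Unit vector condition. -/
def UnitVec {α : Type*} [Fintype α] (ψ : α → ℂ) : Prop :=
  ∑ x, Complex.normSq (ψ x) = 1

/-- Two-party reduced state ρ_АБ of a tripartite pure state. -/
def rhoAB {α β γ : Type*} [Fintype γ] (ψ : α × β × γ → ℂ) :
    Matrix (α × β) (α × β) ℂ :=
  fun p q => ∑ c, ψ (p.1, p.2, c) * (starRingEnd ℂ) (ψ (q.1, q.2, c))

def rhoBC {α β γ : Type*} [Fintype α] (ψ : α × β × γ → ℂ) :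
    Matrix (β × γ) (β × γ) ℂ :=
  fun p q => ∑ a, ψ (a, p.1, p.2) * (starRingEnd ℂ) (ψ (a, q.1, q.2))

def rhoAC {α β γ : Type*} [Fintype β] (ψ : α × β × γ → ℂ) :
    Matrix (α × γ) (α × γ) ℂ :=
  fun p q => ∑ b, ψ (p.1, b, p.2) * (starRingEnd ℂ) (ψ (q.1, b, q.2))

def rhoA {α β γ : Type*} [Fintype β] [Fintype γ] (ψ : α × β × γ → ℂ) :
    Matrix α α ℂ :=
  fun x y => ∑ b, ∑ c, ψ (x, b, c) * (starRingEnd ℂ) (ψ (y, b, c))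

def rhoB {α β γ : Type*} [Fintype α] [Fintype γ] (ψ : α × β × γ → ℂ) :
    Matrix β β ℂ :=
  fun x y => ∑ a, ∑ c, ψ (a, x, c) * (starRingEnd ℂ) (ψ (a, y, c))

def rhoC {α β γ : Type*} [Fintype α] [Fintype β] (ψ : α × β × γ → ℂ) :
    Matrix γ γ ℂ :=
  fun x y => ∑ a, ∑ b, ψ (a, b, x) * (starRingEnd ℂ) (ψ (a, b, y))

/-- `x` majorizes `y` (for nonnegative vectors, with implicit zero padding):
the sum of any `|T|` entries of `y` is dominated by some choice of at most
`|T|` entries of `x`, and the total sums agree. -/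
def Majorizes {α β : Type*} [Fintype α] [Fintype β] (x : α → ℝ) (y : β → ℝ) : Prop :=
  (∀ T : Finset β, ∃ S : Finset α, S.card ≤ T.card ∧ ∑ i ∈ T, y i ≤ ∑ i ∈ S, x i) ∧
  ∑ i, x i = ∑ i, y i

/-- Von Neumann entropy of a Hermitian matrix, via its eigenvalues. -/
def vN {α : Type*} [Fintype α] [DecidableEq α] {ρ : Matrix α α ℂ}
    (h : ρ.IsHermitian) : ℝ :=
  -∑ i, h.eigenvalues i * Real.log (h.eigenvalues i)

/-- Tensor rank of a tripartite vector: least number of product vectors summing to it. -/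
def tensorRank {α β γ : Type*} [Fintype α] [Fintype β] [Fintype γ]
    (ψ : α × β × γ → ℂ) : ℕ :=
  sInf {r : ℕ | ∃ (a : Fin r → α → ℂ) (b : Fin r → β → ℂ) (c : Fin r → γ → ℂ),
    ∀ x, ψ x = ∑ i, a i x.1 * b i x.2.1 * c i x.2.2}

/-- Orthonormal family of vectors. -/
def OrthonormalFam {α : Type*} [Fintype α] {k : ℕ} (v : Fin k → α → ℂ) : Prop :=
  ∀ i j, ∑ x, (starRingEnd ℂ) (v i x) * v j x = if i = j then 1 else 0

/-- Maximally correlated state: ρ = Σ_{i,j} c_{ij} |i_B⟩⟨j_B| ⊗ |i_C⟩⟨j_C|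
for some orthonormal families. -/
def IsMaxCorrelated {β γ : Type*} [Fintype β] [Fintype γ]
    (ρ : Matrix (β × γ) (β × γ) ℂ) : Prop :=
  ∃ (k : ℕ) (c : Matrix (Fin k) (Fin k) ℂ) (e : Fin k → β → ℂ) (f : Fin k → γ → ℂ),
    OrthonormalFam e ∧ OrthonormalFam f ∧
    ∀ p q, ρ p q = ∑ i, ∑ j,
      c i j * (e i p.1 * (starRingEnd ℂ) (e j q.1)) * (f i p.2 * (starRingEnd ℂ) (f j q.2))

/-- Bregman divergence of `x log x`: nonnegative, and zero only on the diagonal. -/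
lemma eq_of_mul_log_sub_le {x y : ℝ} (hx : 0 ≤ x) (hy : 0 ≤ y) (hxy : y = 0 → x = 0)
    (h : x * Real.log x - x * Real.log y - x + y ≤ 0) : x = y := by
  rcases hx.eq_or_lt with rfl | hx
  · simp at h; linarith
  have hy : 0 < y := hy.lt_of_ne fun h0 => hx.ne' (hxy h0.symm)
  by_contra hne
  have h1 : y / x ≠ 1 := fun h' => hne ((div_eq_one_iff_eq hx.ne').1 h').symm
  have h2 := Real.log_lt_sub_one_of_pos (div_pos hy hx) h1
  rw [Real.log_div hy.ne' hx.ne'] at h2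
  have h3 := mul_lt_mul_of_pos_left h2 hx
  have h4 : x * (y / x - 1) = y - x := by field_simp
  nlinarith

lemma mul_log_sub_nonneg {x y : ℝ} (hx : 0 ≤ x) (hy : 0 ≤ y) (hxy : y = 0 → x = 0) :
    0 ≤ x * Real.log x - x * Real.log y - x + y := by
  by_contra! h
  obtain rfl := eq_of_mul_log_sub_le hx hy hxy h.le
  simp at h

/-- If `l` is the image of `m` under a substochastic matrix that is column stochastic on the
support of `m`, and the two have the same Shannon entropy, then they have the same purity. -/
lemma sum_sq_eq_of_entropy_eq {ι κ : Type*} [Fintype ι] [Fintype κ] {l : ι → ℝ} {m : κ → ℝ}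
    {D : ι → κ → ℝ} (hm : ∀ k, 0 ≤ m k) (hD : ∀ j k, 0 ≤ D j k)
    (hl : ∀ j, l j = ∑ k, D j k * m k) (hcol : ∀ k, m k ≠ 0 → ∑ j, D j k = 1)
    (hrow : ∀ j, ∑ k, D j k ≤ 1)
    (hent : ∑ j, l j * Real.log (l j) = ∑ k, m k * Real.log (m k)) :
    ∑ j, l j ^ 2 = ∑ k, m k ^ 2 := by
  have hl0 : ∀ j, 0 ≤ l j := fun j => by
    rw [hl]; exact Finset.sum_nonneg fun k _ => mul_nonneg (hD j k) (hm k)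
  have hle : ∀ j k, D j k * m k ≤ l j := fun j k => by
    rw [hl j]
    exact Finset.single_le_sum (f := fun k => D j k * m k)
      (fun k _ => mul_nonneg (hD j k) (hm k)) (Finset.mem_univ k)
  have hcol' : ∀ f : ℝ → ℝ, f 0 = 0 → ∑ j, ∑ k, D j k * f (m k) = ∑ k, f (m k) := fun f hf => by
    rw [Finset.sum_comm]
    refine Finset.sum_congr rfl fun k _ => ?_
    rw [← Finset.sum_mul]
    by_cases h : m k = 0
    · simp [h, hf]
    · rw [hcol k h, one_mul]
  have hrow' : ∀ f : ℝ → ℝ, ∑ j, ∑ k, D j k * (m k * f (l j)) = ∑ j, l j * f (l j) := fun f => by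
    refine Finset.sum_congr rfl fun j _ => ?_
    conv_rhs => rw [← mul_one (l j * f (l j)), mul_assoc, hl j, Finset.sum_mul, ← hl j]
    exact Finset.sum_congr rfl fun k _ => by ring
  have hsupp : ∀ j k, D j k ≠ 0 → l j = 0 → m k = 0 := fun j k h h0 => by
    have h1 : D j k * m k = 0 :=
      le_antisymm (h0 ▸ hle j k) (mul_nonneg (hD j k) (hm k))
    exact (mul_eq_zero.1 h1).resolve_left h
  set g : ι → κ → ℝ := fun j k =>
    D j k * (m k * Real.log (m k) - m k * Real.log (l j) - m k + l j) with hg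
  have hg0 : ∀ j k, 0 ≤ g j k := fun j k => by
    by_cases h : D j k = 0
    · simp [hg, h]
    · exact mul_nonneg (hD j k) (mul_log_sub_nonneg (hm k) (hl0 j) (hsupp j k h))
  have hsum : ∑ j, ∑ k, g j k ≤ 0 := by
    have e1 := hcol' (fun x => x * Real.log x) (by simp)
    have e2 := hrow' Real.log
    have e3 := hrow' fun _ => 1
    have e4 : ∑ j, ∑ k, D j k * l j ≤ ∑ j, l j := Finset.sum_le_sum fun j _ => by
      rw [← Finset.sum_mul]
      exact mul_le_of_le_one_left (hl0 j) (hrow j)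
    simp only [mul_one] at e3
    simp only [hg, mul_sub, mul_add, Finset.sum_add_distrib, Finset.sum_sub_distrib]
    linarith
  have hzero : ∀ j k, g j k = 0 := fun j k => by
    have h1 := (Finset.sum_eq_zero_iff_of_nonneg fun j _ =>
      Finset.sum_nonneg fun k _ => hg0 j k).1
      (hsum.antisymm (Finset.sum_nonneg fun j _ => Finset.sum_nonneg fun k _ => hg0 j k))
      j (Finset.mem_univ j)
    exact (Finset.sum_eq_zero_iff_of_nonneg fun k _ => hg0 j k).1 h1 k (Finset.mem_univ k)
  have heq : ∀ j k, D j k ≠ 0 → m k = l j := fun j k h =>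
    eq_of_mul_log_sub_le (hm k) (hl0 j) (hsupp j k h)
      (((mul_eq_zero.1 (hzero j k)).resolve_left h).le)
  rw [← hcol' (fun x => x ^ 2) (by simp)]
  refine Finset.sum_congr rfl fun j _ => ?_
  rw [sq]
  nth_rw 1 [hl j]
  rw [Finset.sum_mul]
  refine Finset.sum_congr rfl fun k _ => ?_
  by_cases h : D j k = 0
  · simp [h]
  · rw [heq j k h]; ring

lemma star_dotProduct_self_eq {α : Type*} [Fintype α] (v : α → ℂ) :
    star v ⬝ᵥ v = ((∑ i, Complex.normSq (v i) : ℝ) : ℂ) := by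
  simp [dotProduct, Complex.normSq_eq_conj_mul_self]

/-- Bessel's inequality for a matrix whose rows are orthonormal or zero. -/
lemma sum_normSq_mulVec_le {κ ι : Type*} [Fintype κ] [Fintype ι] [DecidableEq κ]
    {V : Matrix κ ι ℂ} {d : κ → ℂ} (hd : ∀ k i, d k * V k i = V k i)
    (hV : V * Vᴴ = diagonal d) (t : ι → ℂ) :
    ∑ k, Complex.normSq ((V *ᵥ t) k) ≤ ∑ i, Complex.normSq (t i) := by
  have hV' : V * Vᴴ * V = V := by
    ext k i
    rw [hV, diagonal_mul]
    exact hd k i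
  set r := t - Vᴴ *ᵥ (V *ᵥ t)
  have h1 : star r ⬝ᵥ r = star t ⬝ᵥ t - star (V *ᵥ t) ⬝ᵥ (V *ᵥ t) := by
    have h2 : V *ᵥ r = 0 := by
      simp only [r, mulVec_sub, mulVec_mulVec, ← Matrix.mul_assoc, hV', sub_self]
    have h3 : star r ⬝ᵥ r = star t ⬝ᵥ r := by
      conv_lhs => enter [1]; simp only [r]
      rw [star_sub, sub_dotProduct, star_mulVec, conjTranspose_conjTranspose, ← dotProduct_mulVec,
        h2, dotProduct_zero, sub_zero]
    rw [h3]
    simp only [r, dotProduct_sub]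
    rw [dotProduct_mulVec, star_mulVec]
  rw [star_dotProduct_self_eq, star_dotProduct_self_eq, star_dotProduct_self_eq,
    ← Complex.ofReal_sub] at h1
  have h4 := Complex.ofReal_injective h1
  have h5 : 0 ≤ ∑ i, Complex.normSq (r i) := Finset.sum_nonneg fun i _ => Complex.normSq_nonneg _
  linarith

lemma Matrix.IsHermitian.exists_unitary_diagonal {n : Type*} [Fintype n] [DecidableEq n] {A : Matrix n n ℂ}
    (hA : A.IsHermitian) : ∃ U : Matrix n n ℂ, Uᴴ * U = 1 ∧ U * Uᴴ = 1 ∧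
      A = U * diagonal (fun i => (hA.eigenvalues i : ℂ)) * Uᴴ := by
  refine ⟨hA.eigenvectorUnitary, ?_, ?_, ?_⟩
  · exact Unitary.coe_star_mul_self hA.eigenvectorUnitary
  · exact Unitary.coe_mul_star_self hA.eigenvectorUnitary
  · exact hA.spectral_theorem

lemma conjTranspose_mul_self_apply_self {m n : Type*} [Fintype m] (W : Matrix m n ℂ) (k : n) :
    (Wᴴ * W) k k = ((∑ j, Complex.normSq (W j k) : ℝ) : ℂ) := by
  simp [mul_apply, Complex.normSq_eq_conj_mul_self]

lemma mul_conjTranspose_self_apply_self {m n : Type*} [Fintype n] (W : Matrix m n ℂ) (k : m) :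
    (W * Wᴴ) k k = ((∑ j, Complex.normSq (W k j) : ℝ) : ℂ) := by
  simp [mul_apply, Complex.mul_conj]

lemma conjTranspose_diagonal_ofReal {n : Type*} [DecidableEq n] (l : n → ℝ) :
    (diagonal fun i => (l i : ℂ))ᴴ = diagonal fun i => (l i : ℂ) := by
  simp [diagonal_conjTranspose, Pi.star_def]

lemma Matrix.IsHermitian.trace_mul_self {n : Type*} [Fintype n] [DecidableEq n] {A : Matrix n n ℂ}
    (hA : A.IsHermitian) : (A * A).trace = ((∑ i, hA.eigenvalues i ^ 2 : ℝ) : ℂ) := by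
  obtain ⟨U, h1, -, h3⟩ := hA.exists_unitary_diagonal
  set L := diagonal fun i => (hA.eigenvalues i : ℂ) with hL
  have : A * A = U * (L * L) * Uᴴ := by
    calc A * A = U * L * (Uᴴ * U) * L * Uᴴ := by
          nth_rw 1 2 [h3]; simp only [Matrix.mul_assoc]
      _ = _ := by rw [h1]; simp only [Matrix.mul_assoc, Matrix.mul_one]
  rw [this, trace_mul_comm, ← Matrix.mul_assoc, h1, Matrix.one_mul, hL, diagonal_mul_diagonal,
    trace_diagonal]
  simp [sq]

lemma trace_mul_self_eq_sum_normSq_gram {m n ι : Type*} [Fintype m] [Fintype n] [Fintype ι]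
    {M : Matrix m n ℂ} {X : Matrix n ι ℂ} (h : Mᴴ * M = X * Xᴴ) :
    (M * Mᴴ * (M * Mᴴ)).trace
      = ((∑ i, ∑ j, Complex.normSq ((Xᴴ * X) i j) : ℝ) : ℂ) := by
  have h1 : (M * Mᴴ * (M * Mᴴ)).trace = ((Xᴴ * X) * (Xᴴ * X)ᴴ).trace := by
    calc _ = (M * ((Mᴴ * M) * Mᴴ)).trace := by simp only [Matrix.mul_assoc]
      _ = ((Mᴴ * M) * (Mᴴ * M)).trace := by
        rw [trace_mul_comm]; simp only [Matrix.mul_assoc]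
      _ = (X * (Xᴴ * X * Xᴴ)).trace := by rw [h]; simp only [Matrix.mul_assoc]
      _ = _ := by
        rw [trace_mul_comm, conjTranspose_mul, conjTranspose_conjTranspose]
        simp only [Matrix.mul_assoc]
  rw [h1, trace]
  simp only [diag_apply, mul_conjTranspose_self_apply_self]
  push_cast
  rfl

/-- Two Gram factorizations of the same positive matrix: in the eigenbasis of `M * Mᴴ`, the rows
of `M` are combinations of the columns of `X`, with coefficients orthonormal on the support. -/
lemma exists_gram_factor {m n ι : Type*} [Fintype m] [Fintype n] [Fintype ι] [DecidableEq m]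
    {M : Matrix m n ℂ} {X : Matrix n ι ℂ} (h : Mᴴ * M = X * Xᴴ) {ρ : Matrix m m ℂ}
    (hρ : ρ.IsHermitian) (hM : M * Mᴴ = ρ) :
    ∃ (U : Matrix m m ℂ) (V : Matrix m ι ℂ) (d : m → ℂ), Uᴴ * U = 1 ∧ U * Uᴴ = 1 ∧
      ρ = U * diagonal (fun i => (hρ.eigenvalues i : ℂ)) * Uᴴ ∧
      Uᴴ * M = V * Xᴴ ∧ Uᴴ * M * X = diagonal (fun i => (hρ.eigenvalues i : ℂ)) * V ∧
      V * Vᴴ = diagonal d ∧ (∀ k, d k = 0 ∨ d k = 1) ∧ ∀ k i, d k * V k i = V k i := by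
  obtain ⟨U, h1, h2, h3⟩ := hρ.exists_unitary_diagonal
  set l := hρ.eigenvalues
  set L := diagonal fun i => (l i : ℂ) with hL
  set L' := diagonal fun i => (((l i)⁻¹ : ℝ) : ℂ) with hL'
  set Z := Uᴴ * M with hZ
  have hLH' : L'ᴴ = L' := conjTranspose_diagonal_ofReal _
  have hZZ : Z * Zᴴ = L := by
    calc Z * Zᴴ = Uᴴ * (M * Mᴴ) * U := by
          rw [hZ, conjTranspose_mul, conjTranspose_conjTranspose]; simp only [Matrix.mul_assoc]
      _ = (Uᴴ * U) * L * (Uᴴ * U) := by rw [hM, h3]; simp only [Matrix.mul_assoc]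
      _ = L := by rw [h1, Matrix.one_mul, Matrix.mul_one]
  have hZZ' : Zᴴ * Z = X * Xᴴ := by
    calc Zᴴ * Z = Mᴴ * (U * Uᴴ) * M := by
          rw [hZ, conjTranspose_mul, conjTranspose_conjTranspose]; simp only [Matrix.mul_assoc]
      _ = X * Xᴴ := by rw [h2, Matrix.mul_one, h]
  have hZ0 : ∀ k, l k = 0 → ∀ e, Z k e = 0 := fun k hk e => by
    have h4 := mul_conjTranspose_self_apply_self Z k
    rw [hZZ, hL, diagonal_apply_eq, hk] at h4
    have h5 := (Finset.sum_eq_zero_iff_of_nonneg fun j _ => Complex.normSq_nonneg (Z k j)).1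
      (Complex.ofReal_injective h4).symm e (Finset.mem_univ e)
    exact Complex.normSq_eq_zero.1 h5
  have hLL : L' * L * Z = Z := by
    ext k e
    rw [hL, hL', diagonal_mul_diagonal, diagonal_mul]
    by_cases hk : l k = 0
    · simp [hZ0 k hk e]
    · have : (l k : ℂ) ≠ 0 := by exact_mod_cast hk
      simp [this]
  have hLc : L * L' = L' * L := by
    rw [hL, hL', diagonal_mul_diagonal, diagonal_mul_diagonal]; simp only [mul_comm]
  have hLL' : L' * L = diagonal fun k => if l k = 0 then (0 : ℂ) else 1 := by
    rw [hL, hL', diagonal_mul_diagonal]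
    congr 1; ext k
    by_cases hk : l k = 0 <;> simp [hk]
  refine ⟨U, L' * Z * X, fun k => if l k = 0 then 0 else 1, h1, h2, h3, ?_, ?_, ?_, ?_, ?_⟩
  · calc Z = L' * L * Z := hLL.symm
      _ = L' * Z * (Zᴴ * Z) := by rw [← hZZ]; simp only [Matrix.mul_assoc]
      _ = _ := by rw [hZZ']; simp only [Matrix.mul_assoc]
  · calc Z * X = (L' * L) * Z * X := by rw [hLL]
      _ = _ := by rw [← hLc]; simp only [Matrix.mul_assoc]
  · calc L' * Z * X * (L' * Z * X)ᴴ = L' * Z * (X * Xᴴ) * Zᴴ * L'ᴴ := by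
          simp only [conjTranspose_mul, Matrix.mul_assoc]
      _ = L' * (Z * Zᴴ) * (Z * Zᴴ) * L' := by rw [← hZZ', hLH']; simp only [Matrix.mul_assoc]
      _ = (L' * L) * (L' * L) := by rw [hZZ, ← hLc]; simp only [Matrix.mul_assoc]
      _ = _ := by
        rw [hLL', diagonal_mul_diagonal]
        congr 1; ext k; split_ifs <;> simp
  · intro k
    dsimp only
    split_ifs <;> simp
  · intro k i
    have : L' * L * (L' * Z * X) = L' * Z * X := by
      calc _ = L' * (L * L') * Z * X := by simp only [Matrix.mul_assoc]
        _ = L' * (L' * L * Z) * X := by rw [hLc]; simp only [Matrix.mul_assoc]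
        _ = _ := by rw [hLL]
    rw [hLL'] at this
    have := congrFun (congrFun this k) i
    rwa [diagonal_mul] at this

lemma Matrix.PosSemidef.exists_eq_sum_normalized {n : Type*} [Fintype n] {A : Matrix n n ℂ}
    (hA : A.PosSemidef) : ∃ (U : Matrix n n ℂ) (s : n → ℝ),
      (∀ k, ∑ i, Complex.normSq (U i k) = 1) ∧ (∀ k, 0 ≤ s k) ∧
      ∀ i j, A i j = ∑ k, (s k : ℂ) * (U i k * star (U j k)) := by
  classical
  obtain ⟨U, h1, -, h3⟩ := hA.isHermitian.exists_unitary_diagonal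
  refine ⟨U, hA.isHermitian.eigenvalues, fun k => ?_, hA.eigenvalues_nonneg, fun i j => ?_⟩
  · have := conjTranspose_mul_self_apply_self U k
    rw [h1, one_apply_eq] at this
    exact_mod_cast this.symm
  · conv_lhs => rw [h3]
    rw [mul_apply]
    refine Finset.sum_congr rfl fun k _ => ?_
    rw [mul_diagonal, conjTranspose_apply]
    ring

/-- A separable state is a sum of projections onto product vectors whose first factor is a
unit vector. -/
lemma SeparableState.exists_product_vectors {β γ : Type*} [Fintype β] [Fintype γ]
    {R : Matrix (β × γ) (β × γ) ℂ} (h : SeparableState R) :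
    ∃ (k : ℕ) (u : Fin k × β × γ → β → ℂ) (x : Fin k × β × γ → γ → ℂ),
      (∀ i, ∑ b, Complex.normSq (u i b) = 1) ∧
      ∀ b c b' c', R (b, c) (b', c') = ∑ i, u i b * x i c * star (u i b' * x i c') := by
  obtain ⟨k, p, σ, τ, hp, -, hσ, hτ, rfl⟩ := h
  choose U s hU hs hσ using fun i => (hσ i).1.exists_eq_sum_normalized
  choose W t hW ht hτ using fun i => (hτ i).1.exists_eq_sum_normalized
  refine ⟨k, fun i b => U i.1 b i.2.1,
    fun i c => (Real.sqrt (p i.1 * s i.1 i.2.1 * t i.1 i.2.2) : ℂ) * W i.1 c i.2.2,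
    fun i => hU _ _, fun b c b' c' => ?_⟩
  simp only [Matrix.sum_apply, Matrix.smul_apply, tens, smul_eq_mul]
  rw [Fintype.sum_prod_type]
  refine Finset.sum_congr rfl fun i _ => ?_
  rw [hσ, hτ, Finset.sum_mul_sum, Finset.mul_sum, Fintype.sum_prod_type]
  refine Finset.sum_congr rfl fun m _ => ?_
  rw [Finset.mul_sum]
  refine Finset.sum_congr rfl fun n _ => ?_
  have h0 : 0 ≤ p i * s i m * t i n := mul_nonneg (mul_nonneg (hp i) (hs i m)) (ht i n)
  have h1 : (Real.sqrt (p i * s i m * t i n) : ℂ) * Real.sqrt (p i * s i m * t i n)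
      = p i * s i m * t i n := by
    rw [← Complex.ofReal_mul, Real.mul_self_sqrt h0]; push_cast; rfl
  simp only [star_mul', Complex.star_def, Complex.conj_ofReal]
  linear_combination (-(U i b m * W i c n * (starRingEnd ℂ) (U i b' m)
    * (starRingEnd ℂ) (W i c' n))) * h1

lemma sum_normSq_sub_smul {β : Type*} [Fintype β] {v w : β → ℂ}
    (hv : ∑ b, Complex.normSq (v b) = 1) (hw : ∑ b, Complex.normSq (w b) = 1) :
    ∑ b, Complex.normSq (w b - (star v ⬝ᵥ w) * v b) = 1 - Complex.normSq (star v ⬝ᵥ w) := by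
  set s := star v ⬝ᵥ w with hs
  apply Complex.ofReal_injective
  have h1 : star w ⬝ᵥ v = star s := by rw [hs, star_dotProduct]
  have h2 := star_dotProduct_self_eq (w - s • v)
  simp only [Pi.sub_apply, Pi.smul_apply, smul_eq_mul] at h2
  rw [← h2, star_sub, star_smul, sub_dotProduct, dotProduct_sub, dotProduct_sub, smul_dotProduct,
    smul_dotProduct, dotProduct_smul, dotProduct_smul, star_dotProduct_self_eq,
    star_dotProduct_self_eq, hv, hw, h1, ← hs]
  simp only [smul_eq_mul, Complex.ofReal_sub, Complex.normSq_eq_conj_mul_self, Complex.star_def]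
  push_cast
  ring

lemma normSq_star_dotProduct_le_one {β : Type*} [Fintype β] {v w : β → ℂ}
    (hv : ∑ b, Complex.normSq (v b) = 1) (hw : ∑ b, Complex.normSq (w b) = 1) :
    Complex.normSq (star v ⬝ᵥ w) ≤ 1 := by
  have h1 := sum_normSq_sub_smul hv hw
  have h2 : 0 ≤ ∑ b, Complex.normSq (w b - (star v ⬝ᵥ w) * v b) :=
    Finset.sum_nonneg fun b _ => Complex.normSq_nonneg _
  linarith

/-- Unit vectors with overlap of modulus one span the same projection. -/
lemma projv_eq_of_normSq_eq_one {β : Type*} [Fintype β] {v w : β → ℂ}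
    (hv : ∑ b, Complex.normSq (v b) = 1) (hw : ∑ b, Complex.normSq (w b) = 1)
    (h : Complex.normSq (star v ⬝ᵥ w) = 1) : projv w = projv v := by
  have h1 := sum_normSq_sub_smul hv hw
  rw [h, sub_self] at h1
  have h2 : ∀ b, w b = (star v ⬝ᵥ w) * v b := fun b => by
    have := (Finset.sum_eq_zero_iff_of_nonneg fun b _ => Complex.normSq_nonneg _).1 h1 b
      (Finset.mem_univ b)
    exact sub_eq_zero.1 (Complex.normSq_eq_zero.1 this)
  have h3 : (star v ⬝ᵥ w) * (starRingEnd ℂ) (star v ⬝ᵥ w) = 1 := by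
    rw [Complex.mul_conj, h, Complex.ofReal_one]
  ext b b'
  simp only [projv]
  rw [h2 b, h2 b', map_mul]
  linear_combination (v b * (starRingEnd ℂ) (v b')) * h3

lemma eq_smul_of_projv_eq {β : Type*} [Fintype β] {v w : β → ℂ}
    (hw : ∑ b, Complex.normSq (w b) = 1) (h : projv w = projv v) (b : β) :
    w b = (star v ⬝ᵥ w) * v b := by
  have h1 : w b = ∑ b', projv w b b' * w b' := by
    have h2 := star_dotProduct_self_eq w
    rw [hw] at h2
    simp only [projv, mul_assoc, ← Finset.mul_sum]
    have h3 : ∑ i, (starRingEnd ℂ) (w i) * w i = 1 := by simpa [dotProduct] using h2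
    rw [h3, mul_one]
  rw [h1, h]
  simp only [projv, dotProduct, Finset.sum_mul, Pi.star_apply, Complex.star_def]
  exact Finset.sum_congr rfl fun b' _ => by ring

lemma sum_normSq_conjTranspose_mul {m n : Type*} [Fintype m] [DecidableEq m]
    {U : Matrix m m ℂ} (hU : U * Uᴴ = 1) (W : Matrix m n ℂ) (k : n) :
    ∑ j, Complex.normSq ((Uᴴ * W) j k) = ∑ j, Complex.normSq (W j k) := by
  apply Complex.ofReal_injective
  rw [← conjTranspose_mul_self_apply_self, ← conjTranspose_mul_self_apply_self,
    conjTranspose_mul, conjTranspose_conjTranspose,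
    show Wᴴ * U * (Uᴴ * W) = Wᴴ * (U * Uᴴ) * W by simp only [Matrix.mul_assoc], hU, Matrix.mul_one]

/-- The amplitudes of a tripartite vector, cut as first versus the other two systems. -/
def cutFirst {α β γ : Type*} (ψ : α × β × γ → ℂ) : Matrix α (β × γ) ℂ := fun a e => ψ (a, e)

/-- The amplitudes of a tripartite vector, cut as first two systems versus the last. -/
def cutLast {α β γ : Type*} (ψ : α × β × γ → ℂ) : Matrix (α × β) γ ℂ := fun p c => ψ (p.1, p.2, c)

/-- The (conjugated) product vectors as the columns of a matrix. -/
def productFrame {β γ ι : Type*} (u : ι → β → ℂ) (x : ι → γ → ℂ) : Matrix (β × γ) ι ℂ :=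
  fun e i => star (u i e.1 * x i e.2)

/-- The (conjugated) second factors as the columns of a matrix. -/
def lastFrame {γ ι : Type*} (x : ι → γ → ℂ) : Matrix γ ι ℂ := fun c i => star (x i c)

lemma cutFirst_mul_conjTranspose {α β γ : Type*} [Fintype β] [Fintype γ] (ψ : α × β × γ → ℂ) :
    cutFirst ψ * (cutFirst ψ)ᴴ = rhoA ψ := by
  ext a a'
  simp [cutFirst, rhoA, mul_apply, Fintype.sum_prod_type]

lemma cutLast_mul_conjTranspose {α β γ : Type*} [Fintype γ] (ψ : α × β × γ → ℂ) :
    cutLast ψ * (cutLast ψ)ᴴ = rhoAB ψ := by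
  ext a a'
  simp [cutLast, rhoAB, mul_apply]

/-- Equality of the entropies of `ρ_A` and `ρ_AB` forces equality of their purities when `ρ_BC` is
separable. -/
lemma sum_sq_eigenvalues_eq {α β γ ι : Type*} [Fintype α] [Fintype β] [Fintype γ] [Fintype ι]
    [DecidableEq α] [DecidableEq β]
    {ψ : α × β × γ → ℂ} {u : ι → β → ℂ} {x : ι → γ → ℂ}
    (hu : ∀ i, ∑ b, Complex.normSq (u i b) = 1)
    (hX : (cutFirst ψ)ᴴ * cutFirst ψ = productFrame u x * (productFrame u x)ᴴ)
    (hY : (cutLast ψ)ᴴ * cutLast ψ = lastFrame x * (lastFrame x)ᴴ)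
    (hA : (rhoA ψ).IsHermitian) (hAB : (rhoAB ψ).IsHermitian) (hent : vN hA = vN hAB) :
    ∑ j, hA.eigenvalues j ^ 2 = ∑ k, hAB.eigenvalues k ^ 2 := by
  classical
  obtain ⟨U, V, d, hU1, hU2, hρ, hUM, -, hVV, hd01, hdV⟩ :=
    exists_gram_factor hX hA (cutFirst_mul_conjTranspose ψ)
  obtain ⟨U', V', d', hU1', -, hρ', -, hUMX', hVV', -, hdV'⟩ :=
    exists_gram_factor hY hAB (cutLast_mul_conjTranspose ψ)
  set l := hA.eigenvalues
  set m := hAB.eigenvalues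
  set L' := diagonal fun k => (m k : ℂ) with hL'
  set N := cutLast ψ with hN
  set Y := lastFrame x
  have hLH : L'ᴴ = L' := conjTranspose_diagonal_ofReal _
  let Nb : β → Matrix α γ ℂ := fun b a c => N (a, b) c
  let Ub : β → Matrix α (α × β) ℂ := fun b a k => U' (a, b) k
  let B : β → Matrix ι ι ℂ := fun b => diagonal fun i => u i b
  have hNU : N * (Nᴴ * U') = U' * L' := by
    calc N * (Nᴴ * U') = (N * Nᴴ) * U' := by rw [Matrix.mul_assoc]
      _ = U' * L' * (U'ᴴ * U') := by
        rw [hN, cutLast_mul_conjTranspose, hρ', Matrix.mul_assoc]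
      _ = U' * L' := by rw [hU1', Matrix.mul_one]
  have hNbU : ∀ b, Nb b * (Nᴴ * U') = Ub b * L' := fun b => by
    ext a k
    have := congrFun (congrFun hNU (a, b)) k
    simpa only [mul_apply] using this
  have hVB : ∀ b j i, (V * B b) j i = V j i * u i b := fun b j i => mul_diagonal ..
  have hUN : ∀ b, Uᴴ * Nb b = V * B b * Yᴴ := fun b => by
    ext j c
    have := congrFun (congrFun hUM j) (b, c)
    rw [mul_apply (M := V * B b)]
    simp only [hVB, conjTranspose_apply, Y, lastFrame, star_star, mul_assoc]
    rw [mul_apply (M := V)] at this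
    simp only [conjTranspose_apply, productFrame, star_star] at this
    exact this
  have hYN : Yᴴ * (Nᴴ * U') = V'ᴴ * L' := by
    have := congrArg conjTranspose hUMX'
    simpa only [conjTranspose_mul, conjTranspose_conjTranspose, hLH] using this
  have hw : ∀ b, Uᴴ * Ub b * L' = V * B b * V'ᴴ * L' := fun b => by
    calc Uᴴ * Ub b * L' = (Uᴴ * Nb b) * (Nᴴ * U') := by
          rw [Matrix.mul_assoc, ← hNbU, Matrix.mul_assoc]
      _ = V * B b * (Yᴴ * (Nᴴ * U')) := by rw [hUN, Matrix.mul_assoc]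
      _ = _ := by rw [hYN]; simp only [Matrix.mul_assoc]
  have hw' : ∀ b j k, m k ≠ 0 → (V * B b * V'ᴴ) j k = (Uᴴ * Ub b) j k := fun b j k hk => by
    have := congrFun (congrFun (hw b) j) k
    rw [hL', mul_diagonal, mul_diagonal] at this
    exact (mul_right_cancel₀ (by exact_mod_cast hk) this).symm
  have hm0 : ∀ k, 0 ≤ m k := by
    have : (rhoAB ψ).PosSemidef := by
      rw [← cutLast_mul_conjTranspose]; exact posSemidef_self_mul_conjTranspose _
    exact this.eigenvalues_nonneg
  refine sum_sq_eq_of_entropy_eq (D := fun j k => ∑ b, Complex.normSq ((V * B b * V'ᴴ) j k))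
    hm0 (fun j k => Finset.sum_nonneg fun b _ => Complex.normSq_nonneg _) ?_ ?_ ?_ ?_
  · intro j
    apply Complex.ofReal_injective
    have h1 : (l j : ℂ) = (Uᴴ * rhoA ψ * U) j j := by
      have : Uᴴ * rhoA ψ * U = diagonal fun i => (l i : ℂ) := by
        rw [hρ]
        calc _ = (Uᴴ * U) * diagonal (fun i => (l i : ℂ)) * (Uᴴ * U) := by
              simp only [Matrix.mul_assoc]
          _ = _ := by rw [hU1, Matrix.one_mul, Matrix.mul_one]
      rw [this, diagonal_apply_eq]
    have h2 : rhoA ψ = ∑ b, Ub b * L' * (Ub b)ᴴ := by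
      ext a a'
      rw [Matrix.sum_apply]
      refine Finset.sum_congr rfl fun b _ => ?_
      exact congrFun (congrFun hρ' (a, b)) (a', b)
    have h3 : Uᴴ * rhoA ψ * U = ∑ b, (Uᴴ * Ub b) * L' * (Uᴴ * Ub b)ᴴ := by
      rw [h2, Matrix.mul_sum, Matrix.sum_mul]
      refine Finset.sum_congr rfl fun b _ => ?_
      rw [conjTranspose_mul, conjTranspose_conjTranspose]
      simp only [Matrix.mul_assoc]
    rw [h1, h3, Matrix.sum_apply]
    simp only [Finset.sum_mul]
    rw [Finset.sum_comm]
    push_cast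
    refine Finset.sum_congr rfl fun b _ => ?_
    rw [mul_apply]
    refine Finset.sum_congr rfl fun k _ => ?_
    rw [hL', mul_diagonal, conjTranspose_apply]
    by_cases hk : m k = 0
    · simp [hk]
    · rw [hw' b j k hk, ← Complex.mul_conj, Complex.star_def]
      ring
  · intro k hk
    have h1 := conjTranspose_mul_self_apply_self U' k
    rw [hU1', one_apply_eq] at h1
    rw [Finset.sum_comm]
    calc _ = ∑ b, ∑ j, Complex.normSq ((Uᴴ * Ub b) j k) := by
          simp only [hw' _ _ k hk]
      _ = ∑ b, ∑ a, Complex.normSq (U' (a, b) k) := by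
          simp only [sum_normSq_conjTranspose_mul hU2]; rfl
      _ = ∑ p, Complex.normSq (U' p k) := by rw [Fintype.sum_prod_type_right]
      _ = 1 := by exact_mod_cast h1.symm
  · intro j
    rw [Finset.sum_comm]
    have h1 : ∀ b k, Complex.normSq ((V * B b * V'ᴴ) j k)
        = Complex.normSq ((V' *ᵥ fun i => star (V j i * u i b)) k) := fun b k => by
      rw [← Complex.normSq_conj]
      congr 1
      rw [mul_apply]
      simp only [hVB, map_sum, mulVec, dotProduct, conjTranspose_apply]
      refine Finset.sum_congr rfl fun i _ => ?_
      simp only [map_mul, Complex.star_def, Complex.conj_conj]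
      ring
    have h2 := mul_conjTranspose_self_apply_self V j
    rw [hVV, diagonal_apply_eq] at h2
    calc _ ≤ ∑ b, ∑ i, Complex.normSq (star (V j i * u i b)) :=
          Finset.sum_le_sum fun b _ => by
            simp only [h1]; exact sum_normSq_mulVec_le hdV' hVV' _
      _ = ∑ i, Complex.normSq (V j i) := by
          rw [Finset.sum_comm]
          refine Finset.sum_congr rfl fun i _ => ?_
          simp only [Complex.star_def, Complex.normSq_conj, Complex.normSq_mul]
          rw [← Finset.mul_sum, hu, mul_one]
      _ ≤ 1 := by
          rcases hd01 j with h | h <;> rw [h] at h2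
          · rw [← Complex.ofReal_injective (h2 : ((0 : ℝ) : ℂ) = _)]; exact zero_le_one
          · rw [← Complex.ofReal_injective (h2 : ((1 : ℝ) : ℂ) = _)]
  · exact neg_injective hent

lemma trace_tens {α β : Type*} [Fintype α] [Fintype β] (σ : Matrix α α ℂ) (τ : Matrix β β ℂ) :
    (tens σ τ).trace = σ.trace * τ.trace := by
  simp [trace, tens, Fintype.sum_prod_type, Finset.sum_mul_sum]

lemma isDensity_projv {β : Type*} [Fintype β] {v : β → ℂ}
    (hv : ∑ b, Complex.normSq (v b) = 1) : IsDensity (projv v) := by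
  refine ⟨?_, ?_⟩
  · exact posSemidef_vecMulVec_self_star v
  · simp only [trace, diag_apply, projv, Complex.mul_conj]
    exact_mod_cast hv

lemma separableState_of_eq_sum_tens {α β ι : Type*} [Fintype α] [Fintype β] [Fintype ι]
    {ρ : Matrix (α × β) (α × β) ℂ} (hρ : ρ.trace = 1) {σ : ι → Matrix α α ℂ}
    {τ : ι → Matrix β β ℂ} (hσ : ∀ i, (σ i).PosSemidef) (hτ : ∀ i, IsDensity (τ i))
    (h : ρ = ∑ i, tens (σ i) (τ i)) : SeparableState ρ := by
  have htr : ∑ i, (σ i).trace = 1 := by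
    rw [← hρ, h, trace_sum]
    exact Finset.sum_congr rfl fun i _ => by rw [trace_tens, (hτ i).2, mul_one]
  have hnn : ∀ i, 0 ≤ (σ i).trace := fun i => (hσ i).trace_nonneg
  have hre : ∀ i, (((σ i).trace.re : ℝ) : ℂ) = (σ i).trace := fun i =>
    (Complex.eq_re_of_ofReal_le (r := 0) (by simpa using hnn i)).symm
  have hnorm : ∀ i, (σ i).trace ≠ 0 → IsDensity ((σ i).trace⁻¹ • σ i) := fun i hi =>
    ⟨(hσ i).smul (inv_nonneg.2 (hnn i)), by rw [trace_smul, smul_eq_mul, inv_mul_cancel₀ hi]⟩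
  obtain ⟨i₀, hi₀⟩ : ∃ i, (σ i).trace ≠ 0 := by
    by_contra! h0
    simp [h0] at htr
  classical
  let σ' : ι → Matrix α α ℂ := fun i =>
    if (σ i).trace = 0 then (σ i₀).trace⁻¹ • σ i₀ else (σ i).trace⁻¹ • σ i
  have hσ' : ∀ i, IsDensity (σ' i) := fun i => by
    by_cases hi : (σ i).trace = 0
    · simpa only [σ', hi, if_true] using hnorm i₀ hi₀
    · simpa only [σ', hi, if_false] using hnorm i hi
  have hsmul : ∀ i, (σ i).trace • σ' i = σ i := fun i => by
    by_cases hi : (σ i).trace = 0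
    · rw [hi, zero_smul, (hσ i).trace_eq_zero_iff.1 hi]
    · simp only [σ', hi, if_false]
      rw [smul_smul, mul_inv_cancel₀ hi, one_smul]
  let e := Fintype.equivFin ι
  refine ⟨Fintype.card ι, fun j => (σ (e.symm j)).trace.re, fun j => σ' (e.symm j),
    fun j => τ (e.symm j), fun j => ?_, ?_, fun j => hσ' _, fun j => hτ _, ?_⟩
  · exact (Complex.le_def.1 (hnn _)).1
  · rw [Equiv.sum_comp e.symm fun i => (σ i).trace.re, ← Complex.re_sum, htr, Complex.one_re]
  · rw [Equiv.sum_comp e.symm fun i => (((σ i).trace.re : ℝ) : ℂ) • tens (σ' i) (τ i), h]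
    refine Finset.sum_congr rfl fun i _ => ?_
    rw [hre]
    nth_rw 1 [← hsmul i]
    ext p q
    simp only [tens, Matrix.smul_apply, smul_eq_mul, mul_assoc]

lemma trace_rhoAB {α β γ : Type*} [Fintype α] [Fintype β] [Fintype γ] {ψ : α × β × γ → ℂ}
    (hψ : UnitVec ψ) : (rhoAB ψ).trace = 1 := by
  simp only [trace, diag_apply, rhoAB, Complex.mul_conj]
  unfold UnitVec at hψ
  simp only [Fintype.sum_prod_type] at hψ ⊢
  exact_mod_cast hψ

/-- If the components along non-parallel second factors are orthogonal in the third system, then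
tracing that system out leaves a separable state. -/
lemma separableState_rhoAB_of_orthogonal {α β γ ι : Type*} [Fintype α] [Fintype β] [Fintype γ]
    [Fintype ι] {ψ : α × β × γ → ℂ} (hψ : UnitVec ψ) {W : Matrix α ι ℂ} {u : ι → β → ℂ}
    {x : ι → γ → ℂ} (hu : ∀ i, ∑ b, Complex.normSq (u i b) = 1)
    (hW : ∀ a b c, ψ (a, b, c) = ∑ i, W a i * (u i b * x i c))
    (horth : ∀ i j, projv (u i) ≠ projv (u j) → ∑ c, x i c * star (x j c) = 0) :
    SeparableState (rhoAB ψ) := by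
  classical
  obtain hι | hι := isEmpty_or_nonempty ι
  · have h0 : ψ = 0 := by
      ext ⟨a, b, c⟩
      simp [hW]
    simp [UnitVec, h0] at hψ
  let r : ι → ι := fun i => Function.invFun (fun j => projv (u j)) (projv (u i))
  have hr : ∀ i, projv (u i) = projv (u (r i)) := fun i =>
    (Function.invFun_eq (f := fun j => projv (u j)) ⟨i, rfl⟩).symm
  have hr' : ∀ i j, r i ≠ r j → projv (u i) ≠ projv (u j) := fun i j hij h =>
    hij (by simp only [r, h])
  let s : ι → ℂ := fun i => star (u (r i)) ⬝ᵥ u i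
  have hs : ∀ i b, u i b = s i * u (r i) b := fun i b => eq_smul_of_projv_eq (hu i) (hr i) b
  let K : ι → Matrix α γ ℂ := fun t =>
    of fun a c => ∑ i, if r i = t then W a i * s i * x i c else 0
  refine separableState_of_eq_sum_tens (trace_rhoAB hψ) (σ := fun t => K t * (K t)ᴴ)
    (τ := fun t => projv (u t)) (fun t => posSemidef_self_mul_conjTranspose _)
    (fun t => isDensity_projv (hu t)) ?_
  have hψK : ∀ a b c, ψ (a, b, c) = ∑ t, K t a c * u t b := fun a b c => by
    simp only [K, of_apply, Finset.sum_mul, ite_mul, zero_mul]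
    rw [Finset.sum_comm, hW]
    refine Finset.sum_congr rfl fun i _ => ?_
    rw [Finset.sum_ite_eq, if_pos (Finset.mem_univ _), hs i b]
    ring
  have hKK : ∀ t t', t ≠ t' → K t * (K t')ᴴ = 0 := fun t t' htt => by
    ext a a'
    simp only [mul_apply, conjTranspose_apply, K, of_apply, star_sum, Finset.sum_mul_sum]
    rw [Finset.sum_comm]
    refine Finset.sum_eq_zero fun i _ => ?_
    rw [Finset.sum_comm]
    refine Finset.sum_eq_zero fun j _ => ?_
    by_cases hi : r i = t
    · by_cases hj : r j = t'
      · have h0 := horth i j (hr' i j (by rw [hi, hj]; exact htt))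
        simp only [hi, hj, if_true, star_mul']
        calc _ = W a i * s i * (star (W a' j) * star (s j)) * ∑ c, x i c * star (x j c) := by
              rw [Finset.mul_sum]
              exact Finset.sum_congr rfl fun c _ => by ring
          _ = 0 := by rw [h0, mul_zero]
      · simp [hj]
    · simp [hi]
  ext ⟨a, b⟩ ⟨a', b'⟩
  rw [Matrix.sum_apply]
  have h1 : rhoAB ψ (a, b) (a', b')
      = ∑ t, ∑ t', (K t * (K t')ᴴ) a a' * (u t b * star (u t' b')) := by
    simp only [rhoAB, hψK, map_sum, Finset.sum_mul_sum]
    rw [Finset.sum_comm]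
    refine Finset.sum_congr rfl fun t _ => ?_
    rw [Finset.sum_comm]
    refine Finset.sum_congr rfl fun t' _ => ?_
    rw [mul_apply, Finset.sum_mul]
    refine Finset.sum_congr rfl fun c _ => ?_
    simp only [map_mul, conjTranspose_apply, Complex.star_def]
    ring
  rw [h1]
  refine Finset.sum_congr rfl fun t _ => ?_
  rw [Finset.sum_eq_single t (fun t' _ ht => by rw [hKK t t' ht.symm]; simp) (by simp)]
  rfl

lemma productFrame_gram {β γ ι : Type*} [Fintype β] [Fintype γ] (u : ι → β → ℂ) (x : ι → γ → ℂ)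
    (i j : ι) : ((productFrame u x)ᴴ * productFrame u x) i j
      = star (star (u i) ⬝ᵥ u j) * ((lastFrame x)ᴴ * lastFrame x) i j := by
  simp only [mul_apply, conjTranspose_apply, productFrame, lastFrame, dotProduct, star_sum,
    Finset.sum_mul_sum, Fintype.sum_prod_type, Pi.star_apply, star_mul', star_star]
  exact Finset.sum_congr rfl fun b _ => Finset.sum_congr rfl fun c _ => by ring

/-- Lemma 5 of the paper: if ρ_BC is separable and
H(ρ_A) = H(ρ_AB), then ρ_AB is separable. -/
theorem separable_of_separable_env_and_equal_entropy {a b c : ℕ}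
    (ψ : Fin a × Fin b × Fin c → ℂ) (hψ : UnitVec ψ)
    (hsep : SeparableState (rhoBC ψ))
    (hA : (rhoA ψ).IsHermitian) (hAB : (rhoAB ψ).IsHermitian)
    (hent : vN hA = vN hAB) :
    SeparableState (rhoAB ψ) := by
  obtain ⟨k, u, x, hu, hR⟩ := hsep.exists_product_vectors
  have hX : (cutFirst ψ)ᴴ * cutFirst ψ = productFrame u x * (productFrame u x)ᴴ := by
    ext ⟨b, c⟩ ⟨b', c'⟩
    have h1 := hR b' c' b c
    simp only [rhoBC] at h1
    simp only [mul_apply, conjTranspose_apply, cutFirst, productFrame, star_star]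
    simp only [mul_comm (star _)]
    exact h1
  have hY : (cutLast ψ)ᴴ * cutLast ψ = lastFrame x * (lastFrame x)ᴴ := by
    ext c c'
    simp only [mul_apply, conjTranspose_apply, cutLast, lastFrame, star_star]
    rw [Fintype.sum_prod_type_right]
    have h1 : ∀ b, ∑ a, star (ψ (a, b, c)) * ψ (a, b, c')
        = ∑ i, (Complex.normSq (u i b) : ℂ) * (star (x i c) * x i c') := fun b => by
      have h2 := hR b c' b c
      simp only [rhoBC] at h2
      simp only [mul_comm (star _)]
      refine Eq.trans h2 (Finset.sum_congr rfl fun i _ => ?_)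
      rw [← Complex.mul_conj, star_mul', Complex.star_def]
      ring
    simp only [h1]
    rw [Finset.sum_comm]
    refine Finset.sum_congr rfl fun i _ => ?_
    rw [← Finset.sum_mul, ← Complex.ofReal_sum, hu, Complex.ofReal_one, one_mul]
  obtain ⟨U, V, -, -, hU2, -, hUM, -⟩ :=
    exists_gram_factor hX hA (cutFirst_mul_conjTranspose ψ)
  have hM : cutFirst ψ = U * V * (productFrame u x)ᴴ := by
    rw [Matrix.mul_assoc, ← hUM, ← Matrix.mul_assoc, hU2, Matrix.one_mul]
  refine separableState_rhoAB_of_orthogonal (W := U * V) (x := x) hψ hu (fun a b c => ?_) fun i j hij => ?_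
  · have h1 := congrFun (congrFun hM a) (b, c)
    rw [mul_apply] at h1
    simpa only [cutFirst, conjTranspose_apply, productFrame, star_star] using h1
  · have hsq := congrArg ((↑) : ℝ → ℂ) (sum_sq_eigenvalues_eq hu hX hY hA hAB hent)
    rw [← hA.trace_mul_self, ← hAB.trace_mul_self, ← cutFirst_mul_conjTranspose,
      ← cutLast_mul_conjTranspose, trace_mul_self_eq_sum_normSq_gram hX,
      trace_mul_self_eq_sum_normSq_gram hY] at hsq
    replace hsq := Complex.ofReal_injective hsq
    simp only [productFrame_gram, Complex.normSq_mul, Complex.star_def, Complex.normSq_conj] at hsq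
    have hle : ∀ i j, Complex.normSq (star (u i) ⬝ᵥ u j)
        * Complex.normSq (((lastFrame x)ᴴ * lastFrame x) i j)
        ≤ Complex.normSq (((lastFrame x)ᴴ * lastFrame x) i j) := fun i j =>
      mul_le_of_le_one_left (Complex.normSq_nonneg _) (normSq_star_dotProduct_le_one (hu i) (hu j))
    have h1 := (Finset.sum_eq_sum_iff_of_le fun i _ => Finset.sum_le_sum fun j _ => hle i j).1 hsq
      i (Finset.mem_univ i)
    have h2 := (Finset.sum_eq_sum_iff_of_le fun j _ => hle i j).1 h1 j (Finset.mem_univ j)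
    by_contra hne
    refine hij (projv_eq_of_normSq_eq_one (hu i) (hu j) (mul_right_cancel₀ (fun h0 => hne ?_)
      (h2.trans (one_mul _).symm))).symm
    rw [Complex.normSq_eq_zero] at h0
    simpa only [mul_apply, conjTranspose_apply, lastFrame, star_star] using h0

end
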